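/- Let f ∈ ℂ[x₁,…,xₙ] be squarefree and define a free divisor. Then Der(−log f) is a self-normalising Lie subalgebra of the derivations of R: if χ is a ℂ-derivation of R such that ⁅χ,δ⁆(f) ∈ Ideal.span {f} for every ℂ-derivation δ with δ(f) ∈ Ideal.span {f}, then χ(f) ∈ Ideal.span {f}. -/

import Mathlib

open MvPolynomial

/-- Saito's (algebraic) criterion: a squarefree `f ∈ ℂ[x₁,…,xₙ]` defines a free divisor if
there are logarithmic derivations `δ₁,…,δₙ` whose coefficient matrix `(δᵢ(xⱼ))` has
determinant a nonzero scalar multiple of `f`. -/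
def IsFreeDivisor (n : ℕ) (f : MvPolynomial (Fin n) ℂ) : Prop :=
  ∃ δs : Fin n → Derivation ℂ (MvPolynomial (Fin n) ℂ) (MvPolynomial (Fin n) ℂ),
    (∀ i, δs i f ∈ Ideal.span {f}) ∧
    ∃ c : ℂ, c ≠ 0 ∧ (Matrix.of fun i j => δs i (X j)).det = c • f

/-- A squarefree element divides `g` as soon as all its irreducible factors do. -/
theorem Squarefree.dvd_of_forall_irreducible_dvd {M : Type*} [CommMonoidWithZero M]
    [Nontrivial M] [UniqueFactorizationMonoid M] {f g : M} (hf : Squarefree f)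
    (h : ∀ p, Irreducible p → p ∣ f → p ∣ g) : f ∣ g := by
  induction f using WfDvdMonoid.induction_on_irreducible with
  | zero => exact absurd hf not_squarefree_zero
  | unit u hu => exact hu.dvd
  | mul a i _ hi ih =>
    obtain ⟨hrel, -, ha⟩ := squarefree_mul_iff.1 hf
    exact hrel.mul_dvd (h i hi (dvd_mul_right i a))
      (ih ha fun p hp hpa => h p hp (hpa.mul_left i))

/-- The Leibniz rule for a product over a finset, in terms of `Function.update`. -/
theorem Derivation.leibniz_finset_prod {R A ι : Type*} [CommSemiring R] [CommSemiring A]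
    [Algebra R A] [DecidableEq ι] (D : Derivation R A A) (s : Finset ι) (u : ι → A) :
    D (∏ i ∈ s, u i) = ∑ i ∈ s, ∏ k ∈ s, Function.update u i (D (u i)) k := by
  induction s using Finset.induction_on with
  | empty => simp
  | insert a s ha ih =>
    have h₁ : ∏ k ∈ s, Function.update u a (D (u a)) k = ∏ k ∈ s, u k :=
      Finset.prod_congr rfl fun k hk =>
        Function.update_of_ne (ne_of_mem_of_not_mem hk ha) _ _
    have h₂ : ∑ i ∈ s, ∏ k ∈ insert a s, Function.update u i (D (u i)) k
        = u a * ∑ i ∈ s, ∏ k ∈ s, Function.update u i (D (u i)) k := by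
      rw [Finset.mul_sum]
      refine Finset.sum_congr rfl fun i hi => ?_
      rw [Finset.prod_insert ha, Function.update_of_ne (ne_of_mem_of_not_mem hi ha).symm]
    rw [Finset.prod_insert ha, Finset.sum_insert ha, Finset.prod_insert ha, h₁, h₂,
      Function.update_self, D.leibniz, ih, smul_eq_mul, smul_eq_mul]
    ring

/-- Derivative of a determinant, row by row. -/
theorem Derivation.map_det {R A ι : Type*} [CommRing R] [CommRing A] [Algebra R A]
    [DecidableEq ι] [Fintype ι] (D : Derivation R A A) (M : Matrix ι ι A) :
    D M.det = ∑ i, (M.updateRow i fun j => D (M i j)).det := by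
  have hdet (N : Matrix ι ι A) :
      N.det = ∑ σ : Equiv.Perm ι, Equiv.Perm.sign σ • ∏ i, N i (σ i) := by
    rw [← Matrix.det_transpose, Matrix.det_apply]
    rfl
  simp only [hdet, map_sum]
  rw [Finset.sum_comm]
  refine Finset.sum_congr rfl fun σ _ => ?_
  rw [← Finset.smul_sum, Units.smul_def, Units.smul_def, map_zsmul, D.leibniz_finset_prod]
  congr 1
  refine Finset.sum_congr rfl fun i _ => Finset.prod_congr rfl fun k _ => ?_
  obtain rfl | h := eq_or_ne k i
  · simp
  · simp [h]

theorem Matrix.sum_det_updateRow_mul {A ι : Type*} [CommRing A] [DecidableEq ι] [Fintype ι]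
    (M J : Matrix ι ι A) : ∑ i, (M.updateRow i ((M * J) i)).det = M.det * J.trace := by
  have h (i : ι) : (M.updateRow i ((M * J) i)).det = (M * J * M.adjugate) i i := by
    rw [← cramer_transpose_apply, cramer_eq_adjugate_mulVec, ← adjugate_transpose,
      mulVec_transpose]
    rfl
  calc ∑ i, (M.updateRow i ((M * J) i)).det = (M * J * M.adjugate).trace :=
        Finset.sum_congr rfl fun i _ => h i
    _ = M.det * J.trace := by
        rw [trace_mul_comm, ← mul_assoc, adjugate_mul, smul_mul, one_mul, trace_smul, smul_eq_mul]

namespace MvPolynomial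

theorem derivation_apply_eq_sum_pderiv {R σ : Type*} [CommSemiring R] [Fintype σ]
    (D : Derivation R (MvPolynomial σ R) (MvPolynomial σ R)) (f : MvPolynomial σ R) :
    D f = ∑ k, D (X k) * pderiv k f := by
  classical
  have hsum (g : MvPolynomial σ R) :
      (∑ k, D (X k) • pderiv k) g = ∑ k, D (X k) * pderiv k g := by
    rw [← Derivation.coeFnAddMonoidHom_apply, map_sum, Finset.sum_apply]
    rfl
  rw [← hsum]
  refine DFunLike.congr_fun (derivation_ext fun i => ?_) f
  simp [hsum, pderiv_X, Pi.single_apply]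

theorem totalDegree_pderiv_lt {R σ : Type*} [CommSemiring R] {p : MvPolynomial σ R} {k : σ}
    (h : pderiv k p ≠ 0) : (pderiv k p).totalDegree < p.totalDegree := by
  obtain ⟨m, hm, hdeg⟩ := Finset.exists_mem_eq_sup (pderiv k p).support
    (support_nonempty.2 h) (fun s => s.sum fun _ e => e)
  have hm' : m + Finsupp.single k 1 ∈ p.support := by
    rw [mem_support_iff, coeff_pderiv] at hm
    rw [mem_support_iff]
    exact fun h0 => hm (by simp [h0])
  have := le_totalDegree hm'
  rw [Finsupp.sum_add_index' (fun _ => rfl) (fun _ _ _ => rfl), Finsupp.sum_single_index rfl]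
    at this
  rw [totalDegree, hdeg]
  exact this

theorem eq_C_of_forall_pderiv_eq_zero {K σ : Type*} [Field K] [CharZero K]
    {p : MvPolynomial σ K} (h : ∀ k, pderiv k p = 0) : p = C (coeff 0 p) := by
  classical
  ext m
  rw [coeff_C]
  split_ifs with hm
  · rw [hm]
  · obtain ⟨k, hk⟩ := Finsupp.ne_iff.1 (Ne.symm hm)
    have hle : Finsupp.single k 1 ≤ m := by
      rw [Finsupp.single_le_iff]
      exact Nat.one_le_iff_ne_zero.2 hk
    have := congrArg (coeff (m - Finsupp.single k 1)) (h k)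
    rw [coeff_pderiv, tsub_add_cancel_of_le hle, coeff_zero] at this
    exact (mul_eq_zero.1 this).resolve_right (Nat.cast_add_one_ne_zero _)

theorem exists_not_dvd_pderiv {K σ : Type*} [Field K] [CharZero K] {p : MvPolynomial σ K}
    (hp : Irreducible p) : ∃ k, ¬ p ∣ pderiv k p := by
  by_contra! h
  have hz : ∀ k, pderiv k p = 0 := fun k => by
    by_contra hk
    obtain ⟨q, hq⟩ := h k
    have hlt := totalDegree_pderiv_lt hk
    rw [hq, totalDegree_mul_of_isDomain hp.ne_zero (right_ne_zero_of_mul (hq ▸ hk))] at hlt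
    omega
  have hC := eq_C_of_forall_pderiv_eq_zero hz
  refine hp.not_isUnit ?_
  rw [hC]
  refine (IsUnit.mk0 _ fun h0 => hp.ne_zero ?_).map C
  rw [hC, h0, C_0]

theorem _root_.Squarefree.dvd_of_forall_dvd_mul_pderiv {K σ : Type*} [Field K] [CharZero K]
    {f g : MvPolynomial σ K} (hf : Squarefree f) (h : ∀ k, f ∣ g * pderiv k f) : f ∣ g := by
  refine hf.dvd_of_forall_irreducible_dvd fun p hp ⟨q, hq⟩ => ?_
  have hpq : ¬ p ∣ q := fun ⟨r, hr⟩ =>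
    hp.not_isUnit (hf p ⟨r, by rw [hq, hr, mul_assoc]⟩)
  obtain ⟨k, hk⟩ := exists_not_dvd_pderiv hp
  have hdvd : p ∣ g * (pderiv k p * q) + p * (g * pderiv k q) := by
    convert! (Dvd.intro q hq.symm : p ∣ f).trans (h k) using 1
    rw [hq, pderiv_mul]
    ring
  rw [dvd_add_left (dvd_mul_right p _)] at hdvd
  exact (hp.prime.dvd_or_dvd hdvd).resolve_right fun h' =>
    (hp.prime.dvd_or_dvd h').elim hk hpq

/-- A squarefree `f` divides the coefficient determinant of any family of logarithmic
derivations. -/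
theorem _root_.Squarefree.dvd_det_of_logarithmic {K σ : Type*} [Field K] [CharZero K] [Fintype σ]
    [DecidableEq σ] {f : MvPolynomial σ K} (hf : Squarefree f)
    (D : σ → Derivation K (MvPolynomial σ K) (MvPolynomial σ K)) (hD : ∀ i, f ∣ D i f) :
    f ∣ (Matrix.of fun i j => D i (X j)).det := by
  set M : Matrix σ σ (MvPolynomial σ K) := Matrix.of fun i j => D i (X j) with hM
  have hgrad : M.mulVec (fun k => pderiv k f) = fun i => D i f := by
    ext1 i
    rw [derivation_apply_eq_sum_pderiv (D i) f]
    rfl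
  refine hf.dvd_of_forall_dvd_mul_pderiv fun k => ?_
  have hadj : M.det * pderiv k f = M.adjugate.mulVec (fun i => D i f) k := by
    rw [← hgrad, Matrix.mulVec_mulVec, Matrix.adjugate_mul, Matrix.smul_mulVec, Matrix.one_mulVec]
    rfl
  rw [hadj]
  exact Finset.dvd_sum fun i _ => (hD i).mul_left _

end MvPolynomial

/-- `Der(−log f)` is a self-normalising Lie subalgebra of the derivations of `ℂ[x₁,…,xₙ]`:
if `⁅χ,δ⁆` is logarithmic for every logarithmic `δ`, then `χ` is logarithmic. -/
theorem derlog_self_normalising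
    (n : ℕ) (f : MvPolynomial (Fin n) ℂ)
    (hsq : Squarefree f) (hfd : IsFreeDivisor n f)
    (χ : Derivation ℂ (MvPolynomial (Fin n) ℂ) (MvPolynomial (Fin n) ℂ))
    (hχ : ∀ δ : Derivation ℂ (MvPolynomial (Fin n) ℂ) (MvPolynomial (Fin n) ℂ),
      δ f ∈ Ideal.span {f} → ⁅χ, δ⁆ f ∈ Ideal.span {f}) :
    χ f ∈ Ideal.span {f} := by
  simp only [Ideal.mem_span_singleton] at hχ ⊢
  obtain ⟨δ, hδ, c, hc, hdet⟩ := hfd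
  simp only [Ideal.mem_span_singleton] at hδ
  set M : Matrix (Fin n) (Fin n) (MvPolynomial (Fin n) ℂ) :=
    Matrix.of fun i j => δ i (X j) with hM
  let J : Matrix (Fin n) (Fin n) (MvPolynomial (Fin n) ℂ) :=
    Matrix.of fun k j => pderiv k (χ (X j))
  have hrow (i : Fin n) : (fun j => χ (M i j)) = (fun j => ⁅χ, δ i⁆ (X j)) + (M * J) i := by
    ext1 j
    have hJ : (M * J) i j = δ i (χ (X j)) := (derivation_apply_eq_sum_pderiv (δ i) _).symm
    rw [Pi.add_apply, hJ, Derivation.commutator_apply, sub_add_cancel]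
    rfl
  have hbracket (i : Fin n) : f ∣ (M.updateRow i fun j => ⁅χ, δ i⁆ (X j)).det := by
    convert! hsq.dvd_det_of_logarithmic (Function.update δ i ⁅χ, δ i⁆) fun k => ?_ using 2
    · ext1 k j
      obtain rfl | h := eq_or_ne k i
      · simp
      · simp [h, hM]
    · obtain rfl | h := eq_or_ne k i
      · simpa using hχ _ (hδ k)
      · simpa [h] using hδ k
  have hcf : f ∣ c • χ f := by
    rw [← χ.map_smul, ← hdet, χ.map_det]
    simp only [hrow, Matrix.det_updateRow_add, Finset.sum_add_distrib]
    rw [Matrix.sum_det_updateRow_mul, hdet]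
    exact dvd_add (Finset.dvd_sum fun i _ => hbracket i)
      ((dvd_smul_of_dvd c dvd_rfl).mul_right _)
  simpa [smul_smul, inv_mul_cancel₀ hc] using dvd_smul_of_dvd c⁻¹ hcf
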